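/- arXiv:2310.16107 — 2 statements merged into one kernel-verified Lean document; each statement's English description precedes it below -/
import Mathlib

section
/- Quantum relative entropy contracts under conjugation by a unitary followed by partial trace from a product state (Stinespring-form channels): for density matrices ρ, σ on a finite-dimensional Hilbert space H_S, environment state ω on H_E, and unitary U on H_S ⊗ H_E, defining Φ(ρ) = Tr_E[U(ρ⊗ω)U†], one has H(Φ(ρ)||Φ(σ)) ≤ H(ρ||σ) where H(ρ||σ) = Tr[ρ(log ρ − log σ)] (assuming all relevant states have full rank). -/
open Matrix Finset
open scoped ComplexOrder

/-- Matrix logarithm of a Hermitian matrix via its eigendecomposition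
(junk value `0` on non-Hermitian matrices). -/
noncomputable def mlog {d : ℕ} (ρ : Matrix (Fin d) (Fin d) ℂ) : Matrix (Fin d) (Fin d) ℂ :=
  if h : ρ.IsHermitian then
    (h.eigenvectorUnitary : Matrix (Fin d) (Fin d) ℂ) *
      Matrix.diagonal (fun i => ((Real.log (h.eigenvalues i) : ℝ) : ℂ)) *
      (h.eigenvectorUnitary : Matrix (Fin d) (Fin d) ℂ)ᴴ
  else 0

/-- Quantum relative entropy `Tr[ρ (log ρ - log σ)]` of full-rank states. -/
noncomputable def qRelEnt {d : ℕ} (ρ σ : Matrix (Fin d) (Fin d) ℂ) : ℝ :=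
  (Matrix.trace (ρ * (mlog ρ - mlog σ))).re

open Kronecker in
/-- Partial trace over the environment. -/
noncomputable def ptraceE {dS dE : ℕ}
    (M : Matrix (Fin dS × Fin dE) (Fin dS × Fin dE) ℂ) : Matrix (Fin dS) (Fin dS) ℂ :=
  Matrix.of (fun i j => ∑ e : Fin dE, M (i, e) (j, e))

namespace DPIaux

/-- overlap weights -/
noncomputable def W {d : ℕ} {A B : Matrix (Fin d) (Fin d) ℂ} (hA : A.IsHermitian)
    (hB : B.IsHermitian) : Matrix (Fin d) (Fin d) ℂ :=
  (hA.eigenvectorUnitary : Matrix (Fin d) (Fin d) ℂ)ᴴ *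
    (hB.eigenvectorUnitary : Matrix (Fin d) (Fin d) ℂ)

theorem uu {d : ℕ} {A : Matrix (Fin d) (Fin d) ℂ} (hA : A.IsHermitian) :
    (hA.eigenvectorUnitary : Matrix (Fin d) (Fin d) ℂ)ᴴ * (hA.eigenvectorUnitary : Matrix (Fin d) (Fin d) ℂ) = 1 :=
  Unitary.coe_star_mul_self hA.eigenvectorUnitary

theorem uu' {d : ℕ} {A : Matrix (Fin d) (Fin d) ℂ} (hA : A.IsHermitian) :
    (hA.eigenvectorUnitary : Matrix (Fin d) (Fin d) ℂ) * (hA.eigenvectorUnitary : Matrix (Fin d) (Fin d) ℂ)ᴴ = 1 :=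
  Unitary.coe_mul_star_self hA.eigenvectorUnitary

theorem spec {d : ℕ} {A : Matrix (Fin d) (Fin d) ℂ} (hA : A.IsHermitian) :
    A = (hA.eigenvectorUnitary : Matrix (Fin d) (Fin d) ℂ) *
      Matrix.diagonal (fun i => ((hA.eigenvalues i : ℝ) : ℂ)) *
      (hA.eigenvectorUnitary : Matrix (Fin d) (Fin d) ℂ)ᴴ := by
  have := hA.spectral_theorem
  rw [Unitary.conjStarAlgAut_apply] at this
  exact this

theorem trW {d : ℕ} (V V' : Matrix (Fin d) (Fin d) ℂ) (f g : Fin d → ℝ) :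
    (Matrix.trace ((V * Matrix.diagonal (fun i => (f i : ℂ)) * Vᴴ) *
      (V' * Matrix.diagonal (fun i => (g i : ℂ)) * V'ᴴ))).re
      = ∑ i, ∑ j, Complex.normSq ((Vᴴ * V') i j) * f i * g j := by
  have h1 : Matrix.trace ((V * Matrix.diagonal (fun i => (f i : ℂ)) * Vᴴ) *
      (V' * Matrix.diagonal (fun i => (g i : ℂ)) * V'ᴴ))
      = Matrix.trace (Matrix.diagonal (fun i => (f i : ℂ)) * (Vᴴ * V') *
        Matrix.diagonal (fun i => (g i : ℂ)) * (Vᴴ * V')ᴴ) := by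
    rw [Matrix.conjTranspose_mul, Matrix.conjTranspose_conjTranspose]
    simp only [Matrix.mul_assoc]
    rw [Matrix.trace_mul_comm V]
    simp only [Matrix.mul_assoc]
  rw [h1]
  generalize Vᴴ * V' = w
  simp only [Matrix.trace, Matrix.diag, Complex.re_sum]
  refine Finset.sum_congr rfl fun i _ => ?_
  rw [Matrix.mul_apply, Complex.re_sum]
  refine Finset.sum_congr rfl fun j _ => ?_
  rw [Matrix.mul_diagonal, Matrix.diagonal_mul, Matrix.conjTranspose_apply]
  simp [Complex.normSq_apply]
  ring

theorem mlog_eq {d : ℕ} {A : Matrix (Fin d) (Fin d) ℂ} (hA : A.IsHermitian) :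
    mlog A = (hA.eigenvectorUnitary : Matrix (Fin d) (Fin d) ℂ) *
      Matrix.diagonal (fun i => ((Real.log (hA.eigenvalues i) : ℝ) : ℂ)) *
      (hA.eigenvectorUnitary : Matrix (Fin d) (Fin d) ℂ)ᴴ := by
  rw [mlog, dif_pos hA]

theorem sum_W {d : ℕ} {A B : Matrix (Fin d) (Fin d) ℂ} (hA : A.IsHermitian)
    (hB : B.IsHermitian) (f : Fin d → ℝ) :
    ∑ i, ∑ j, Complex.normSq (W hA hB i j) * f i = ∑ i, f i := by
  have := trW (hA.eigenvectorUnitary : Matrix (Fin d) (Fin d) ℂ) hB.eigenvectorUnitary f (fun _ => 1)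
  simp only [mul_one] at this
  rw [W, ← this]
  have e : (Matrix.diagonal (fun _ : Fin d => (((1:ℝ)) : ℂ))) = 1 := by simp
  rw [e, Matrix.mul_one, uu', Matrix.mul_one, Matrix.mul_assoc, Matrix.trace_mul_comm, Matrix.mul_assoc,
    uu, Matrix.mul_one]
  simp [Matrix.trace]

theorem ent_eq {d : ℕ} {A B : Matrix (Fin d) (Fin d) ℂ} (hA : A.IsHermitian)
    (hB : B.IsHermitian) :
    qRelEnt A B = ∑ i, ∑ j, Complex.normSq (W hA hB i j) * (hA.eigenvalues i *
      (Real.log (hA.eigenvalues i) - Real.log (hB.eigenvalues j))) := by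
  have h1 : (Matrix.trace (A * mlog B)).re = ∑ i, ∑ j, Complex.normSq (W hA hB i j) * hA.eigenvalues i *
      Real.log (hB.eigenvalues j) := by
    rw [mlog_eq hB, W, ← trW, ← spec]
  have h2 : (Matrix.trace (A * mlog A)).re = ∑ i, ∑ j, Complex.normSq (W hA hB i j) * (hA.eigenvalues i *
      Real.log (hA.eigenvalues i)) := by
    rw [sum_W]
    have h := trW (hA.eigenvectorUnitary : Matrix (Fin d) (Fin d) ℂ) hA.eigenvectorUnitary
      hA.eigenvalues (fun i => Real.log (hA.eigenvalues i))
    rw [← spec, ← mlog_eq] at h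
    rw [h, uu]
    simp [Matrix.one_apply, apply_ite]
  rw [qRelEnt, Matrix.mul_sub, Matrix.trace_sub, Complex.sub_re, h1, h2, ← Finset.sum_sub_distrib]
  refine Finset.sum_congr rfl fun i _ => ?_
  rw [← Finset.sum_sub_distrib]
  refine Finset.sum_congr rfl fun j _ => ?_
  ring

theorem sum_ev {d : ℕ} {A B : Matrix (Fin d) (Fin d) ℂ} (hA : A.IsHermitian)
    (hB : B.IsHermitian) (h : A.trace = 1) :
    ∑ i, ∑ j, Complex.normSq (W hA hB i j) * hA.eigenvalues i = 1 := by
  rw [sum_W]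
  have := hA.trace_eq_sum_eigenvalues
  rw [h] at this
  have h2 := congrArg Complex.re this
  simpa using h2.symm

/-- variational functional -/
noncomputable def Q {d : ℕ} (A B : Matrix (Fin d) (Fin d) ℂ) (t : ℝ) (M : Matrix (Fin d) (Fin d) ℂ) : ℝ :=
  2 * (Matrix.trace (M * A)).re - (Matrix.trace (M * B * Mᴴ)).re - t * (Matrix.trace (Mᴴ * A * M)).re

/-- its supremum -/
noncomputable def G {d : ℕ} {A B : Matrix (Fin d) (Fin d) ℂ} (hA : A.IsHermitian)
    (hB : B.IsHermitian) (t : ℝ) : ℝ :=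
  ∑ i, ∑ j, Complex.normSq (W hA hB i j) * (hA.eigenvalues i *
    (hA.eigenvalues i / (hB.eigenvalues j + t * hA.eigenvalues i)))

theorem Q_eq {d : ℕ} {A B : Matrix (Fin d) (Fin d) ℂ} (hA : A.IsHermitian)
    (hB : B.IsHermitian) (t : ℝ) (Z : Matrix (Fin d) (Fin d) ℂ) :
    Q A B t ((hA.eigenvectorUnitary : Matrix (Fin d) (Fin d) ℂ) * Z *
      (hB.eigenvectorUnitary : Matrix (Fin d) (Fin d) ℂ)ᴴ) =
    ∑ i, ∑ j, (2 * (Z i j * star (W hA hB i j)).re * hA.eigenvalues i -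
      Complex.normSq (Z i j) * (hB.eigenvalues j + t * hA.eigenvalues i)) := by
  have uA := uu hA
  have uB := uu hB
  have sA := spec hA
  have sB := spec hB
  rw [W, Q]
  set V := (hA.eigenvectorUnitary : Matrix (Fin d) (Fin d) ℂ)
  set V' := (hB.eigenvectorUnitary : Matrix (Fin d) (Fin d) ℂ)
  set p := hA.eigenvalues
  set q := hB.eigenvalues
  have cA : ∀ C, Vᴴ * (V * C) = C := fun C => by rw [← Matrix.mul_assoc, uA, Matrix.one_mul]
  have cB : ∀ C, V'ᴴ * (V' * C) = C := fun C => by rw [← Matrix.mul_assoc, uB, Matrix.one_mul]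
  have e1 : Matrix.trace (V * Z * V'ᴴ * A) = Matrix.trace (Z * (Vᴴ * V')ᴴ * Matrix.diagonal (fun i => (p i : ℂ))) := by
    rw [sA, Matrix.conjTranspose_mul, Matrix.conjTranspose_conjTranspose]
    simp only [Matrix.mul_assoc]
    rw [Matrix.trace_mul_comm V]
    simp only [Matrix.mul_assoc, uA, Matrix.mul_one]
  have e2 : Matrix.trace (V * Z * V'ᴴ * B * (V * Z * V'ᴴ)ᴴ) =
      Matrix.trace (Z * Matrix.diagonal (fun i => (q i : ℂ)) * Zᴴ) := by
    rw [sB]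
    simp only [Matrix.conjTranspose_mul, Matrix.conjTranspose_conjTranspose, Matrix.mul_assoc, cB]
    rw [Matrix.trace_mul_comm V]
    simp only [Matrix.mul_assoc, uA, Matrix.mul_one]
  have e3 : Matrix.trace ((V * Z * V'ᴴ)ᴴ * A * (V * Z * V'ᴴ)) =
      Matrix.trace (Matrix.diagonal (fun i => (p i : ℂ)) * Z * Zᴴ) := by
    rw [sA]
    simp only [Matrix.conjTranspose_mul, Matrix.conjTranspose_conjTranspose, Matrix.mul_assoc, cA]
    rw [Matrix.trace_mul_comm V']
    simp only [Matrix.mul_assoc, uB, Matrix.mul_one]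
    rw [Matrix.trace_mul_comm Zᴴ]
    simp only [Matrix.mul_assoc]
  rw [e1, e2, e3]
  generalize Vᴴ * V' = w
  simp only [Matrix.trace, Matrix.diag, Complex.re_sum, Finset.mul_sum]
  rw [← Finset.sum_sub_distrib, ← Finset.sum_sub_distrib]
  refine Finset.sum_congr rfl fun i _ => ?_
  rw [Matrix.mul_diagonal, Matrix.mul_apply, Matrix.mul_apply, Matrix.mul_apply, Finset.sum_mul, Complex.re_sum,
    Complex.re_sum, Complex.re_sum, Finset.mul_sum, Finset.mul_sum, ← Finset.sum_sub_distrib, ← Finset.sum_sub_distrib]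
  refine Finset.sum_congr rfl fun j _ => ?_
  rw [Matrix.mul_diagonal, Matrix.diagonal_mul, Matrix.conjTranspose_apply, Matrix.conjTranspose_apply]
  simp [Complex.normSq_apply]
  ring

theorem Q_le {d : ℕ} {A B : Matrix (Fin d) (Fin d) ℂ} (hA : A.PosDef)
    (hB : B.PosDef) (t : ℝ) (ht : 0 ≤ t) (M : Matrix (Fin d) (Fin d) ℂ) :
    Q A B t M ≤ G hA.isHermitian hB.isHermitian t := by
  have uA := uu' hA.isHermitian
  have uB := uu' hB.isHermitian
  have h := Q_eq hA.isHermitian hB.isHermitian t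
    ((hA.isHermitian.eigenvectorUnitary : Matrix (Fin d) (Fin d) ℂ)ᴴ * M *
      (hB.isHermitian.eigenvectorUnitary : Matrix (Fin d) (Fin d) ℂ))
  have e : (hA.isHermitian.eigenvectorUnitary : Matrix (Fin d) (Fin d) ℂ) *
    ((hA.isHermitian.eigenvectorUnitary : Matrix (Fin d) (Fin d) ℂ)ᴴ * M *
      (hB.isHermitian.eigenvectorUnitary : Matrix (Fin d) (Fin d) ℂ)) *
      (hB.isHermitian.eigenvectorUnitary : Matrix (Fin d) (Fin d) ℂ)ᴴ = M := by
    simp only [Matrix.mul_assoc, uB, Matrix.mul_one]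
    rw [← Matrix.mul_assoc, uA, Matrix.one_mul]
  rw [e] at h
  rw [h, G]
  refine Finset.sum_le_sum fun i _ => Finset.sum_le_sum fun j _ => ?_
  have hp := hA.eigenvalues_pos i
  have hq := hB.eigenvalues_pos j
  generalize hA.isHermitian.eigenvalues i = p at *
  generalize hB.isHermitian.eigenvalues j = q at *
  generalize W hA.isHermitian hB.isHermitian i j = w
  generalize ((hA.isHermitian.eigenvectorUnitary : Matrix (Fin d) (Fin d) ℂ)ᴴ * M *
      (hB.isHermitian.eigenvectorUnitary : Matrix (Fin d) (Fin d) ℂ)) i j = z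
  have hs : 0 < q + t * p := by positivity
  generalize q + t * p = s at *
  have : Complex.normSq w * (p * (p / s)) - (2 * (z * star w).re * p - Complex.normSq z * s)
     = Complex.normSq (s * z - p * w) / s := by
    simp [Complex.normSq_apply]
    field_simp
    ring
  have h2 : 0 ≤ Complex.normSq (s * z - p * w) / s := div_nonneg (Complex.normSq_nonneg _) hs.le
  linarith

theorem Q_ex {d : ℕ} {A B : Matrix (Fin d) (Fin d) ℂ} (hA : A.PosDef)
    (hB : B.PosDef) (t : ℝ) (ht : 0 ≤ t) :
    ∃ M, Q A B t M = G hA.isHermitian hB.isHermitian t := by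
  refine ⟨_, (Q_eq hA.isHermitian hB.isHermitian t (Matrix.of fun i j =>
    W hA.isHermitian hB.isHermitian i j * ((hA.isHermitian.eigenvalues i /
      (hB.isHermitian.eigenvalues j + t * hA.isHermitian.eigenvalues i) : ℝ) : ℂ))).trans ?_⟩
  rw [G]
  refine Finset.sum_congr rfl fun i _ => Finset.sum_congr rfl fun j _ => ?_
  have hp := hA.eigenvalues_pos i
  have hq := hB.eigenvalues_pos j
  rw [Matrix.of_apply]
  generalize hA.isHermitian.eigenvalues i = p at *
  generalize hB.isHermitian.eigenvalues j = q at *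
  generalize W hA.isHermitian hB.isHermitian i j = w
  have hs : 0 < q + t * p := by positivity
  generalize q + t * p = s at *
  rw [Complex.normSq_mul, Complex.normSq_ofReal]
  have : (w * ((p / s : ℝ) : ℂ) * star w).re = Complex.normSq w * (p / s) := by
    simp only [Complex.normSq_apply, Complex.mul_re, Complex.mul_im, Complex.ofReal_re, Complex.ofReal_im,
      Complex.star_def, Complex.conj_re, Complex.conj_im]
    ring
  rw [this]
  field_simp
  ring

/-- integrated functional -/
noncomputable def g {d : ℕ} {A B : Matrix (Fin d) (Fin d) ℂ} (hA : A.IsHermitian)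
    (hB : B.IsHermitian) (t : ℝ) : ℝ :=
  ∑ i, ∑ j, Complex.normSq (W hA hB i j) * (hA.eigenvalues i *
    (Real.log (hB.eigenvalues j + t * hA.eigenvalues i) - Real.log (hB.eigenvalues j)))

theorem g_deriv {d : ℕ} {A B : Matrix (Fin d) (Fin d) ℂ} (hA : A.PosDef)
    (hB : B.PosDef) (t : ℝ) (ht : 0 ≤ t) :
    HasDerivAt (g hA.isHermitian hB.isHermitian) (G hA.isHermitian hB.isHermitian t) t := by
  unfold g G
  refine HasDerivAt.fun_sum fun i _ => HasDerivAt.fun_sum fun j _ => ?_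
  have hp := hA.eigenvalues_pos i
  have hq := hB.eigenvalues_pos j
  refine HasDerivAt.const_mul _ (HasDerivAt.const_mul _ (HasDerivAt.sub_const _ ?_))
  refine HasDerivAt.log ?_ (by positivity)
  simpa using ((hasDerivAt_id t).mul_const (hA.isHermitian.eigenvalues i)).const_add (hB.isHermitian.eigenvalues j)

theorem g_lim {d : ℕ} {A B : Matrix (Fin d) (Fin d) ℂ} (hA : A.PosDef)
    (hB : B.PosDef) (htr : A.trace = 1) :
    Filter.Tendsto (fun t => g hA.isHermitian hB.isHermitian t - Real.log t) Filter.atTop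
      (nhds (qRelEnt A B)) := by
  rw [ent_eq hA.isHermitian hB.isHermitian]
  have key : Filter.Tendsto (fun t : ℝ => ∑ i, ∑ j, Complex.normSq (W hA.isHermitian hB.isHermitian i j) * (hA.isHermitian.eigenvalues i *
    (Real.log (hB.isHermitian.eigenvalues j / t + hA.isHermitian.eigenvalues i) - Real.log (hB.isHermitian.eigenvalues j)))) Filter.atTop
      (nhds (∑ i, ∑ j, Complex.normSq (W hA.isHermitian hB.isHermitian i j) * (hA.isHermitian.eigenvalues i *
      (Real.log (hA.isHermitian.eigenvalues i) - Real.log (hB.isHermitian.eigenvalues j))))) := by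
    refine tendsto_finsetSum _ fun i _ => tendsto_finsetSum _ fun j _ => ?_
    have hp := hA.eigenvalues_pos i
    refine Filter.Tendsto.const_mul _ (Filter.Tendsto.const_mul _ (Filter.Tendsto.sub_const ?_ _))
    refine Filter.Tendsto.log ?_ hp.ne'
    have : Filter.Tendsto (fun t : ℝ => hB.isHermitian.eigenvalues j / t) Filter.atTop (nhds 0) :=
      Filter.Tendsto.div_atTop tendsto_const_nhds Filter.tendsto_id
    simpa using this.add_const (hA.isHermitian.eigenvalues i)
  refine key.congr' ?_
  filter_upwards [Filter.eventually_gt_atTop 0] with t ht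
  have h1 := sum_ev hA.isHermitian hB.isHermitian htr
  have h2 : Real.log t = ∑ i, ∑ j, Complex.normSq (W hA.isHermitian hB.isHermitian i j) *
      hA.isHermitian.eigenvalues i * Real.log t := by
    have h3 := congrArg (fun x => x * Real.log t) h1
    simp only [Finset.sum_mul, one_mul] at h3
    exact h3.symm
  rw [h2, g, ← Finset.sum_sub_distrib]
  refine Finset.sum_congr rfl fun i _ => ?_
  rw [← Finset.sum_sub_distrib]
  refine Finset.sum_congr rfl fun j _ => ?_
  have hp := hA.eigenvalues_pos i
  have hq := hB.eigenvalues_pos j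
  have : hB.isHermitian.eigenvalues j / t + hA.isHermitian.eigenvalues i =
    (hB.isHermitian.eigenvalues j + t * hA.isHermitian.eigenvalues i) / t := by
    field_simp
  rw [this, Real.log_div (by positivity) ht.ne']
  ring

theorem main {d : ℕ} {A B A' B' : Matrix (Fin d) (Fin d) ℂ} (hA : A.PosDef)
    (hB : B.PosDef) (hA' : A'.PosDef) (hB' : B'.PosDef) (htr : A.trace = 1) (htr' : A'.trace = 1)
    (h : ∀ t, 0 ≤ t → ∀ M, ∃ N, Q A' B' t M ≤ Q A B t N) :
    qRelEnt A' B' ≤ qRelEnt A B := by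
  have hG : ∀ t, 0 ≤ t → G hA'.isHermitian hB'.isHermitian t ≤ G hA.isHermitian hB.isHermitian t := by
    intro t ht
    obtain ⟨M, hM⟩ := Q_ex hA' hB' t ht
    obtain ⟨N, hN⟩ := h t ht M
    rw [← hM]
    exact hN.trans (Q_le hA hB t ht N)
  have hd : ∀ t, 0 ≤ t → HasDerivAt (fun t => g hA.isHermitian hB.isHermitian t - g hA'.isHermitian hB'.isHermitian t) _ t :=
    fun t ht => (g_deriv hA hB t ht).sub (g_deriv hA' hB' t ht)
  have mono : MonotoneOn (fun t => g hA.isHermitian hB.isHermitian t - g hA'.isHermitian hB'.isHermitian t) (Set.Ici 0) := by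
    refine monotoneOn_of_deriv_nonneg (convex_Ici 0) (fun t ht => (hd t ht).continuousAt.continuousWithinAt) ?_ ?_
    · intro t ht
      rw [interior_Ici] at ht
      exact (hd t (le_of_lt ht)).differentiableAt.differentiableWithinAt
    · intro t ht
      rw [interior_Ici] at ht
      rw [(hd t (le_of_lt ht)).deriv]
      exact sub_nonneg.2 (hG t (le_of_lt ht))
  refine le_of_tendsto_of_tendsto (g_lim hA' hB' htr') (g_lim hA hB htr) ?_
  filter_upwards [Filter.eventually_ge_atTop 0] with t ht
  have := mono (Set.self_mem_Ici) (Set.mem_Ici.2 ht) ht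
  simp [g] at this
  simp only [g]
  linarith

theorem tr_nonneg {d : ℕ} {B : Matrix (Fin d) (Fin d) ℂ} (hB : B.PosDef) (X : Matrix (Fin d) (Fin d) ℂ) :
    0 ≤ (Matrix.trace (X * B * Xᴴ)).re :=
  (Complex.le_def.1 (hB.posSemidef.mul_mul_conjTranspose_same X).trace_nonneg).1

theorem KS {d : ℕ} {κ : Type} [Fintype κ] (K : κ → Matrix (Fin d) (Fin d) ℂ)
    (hK : ∑ k, (K k)ᴴ * K k = 1) {B : Matrix (Fin d) (Fin d) ℂ} (hB : B.PosDef)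
    (M : Matrix (Fin d) (Fin d) ℂ) :
    (Matrix.trace ((∑ k, (K k)ᴴ * M * K k) * B * (∑ k, (K k)ᴴ * M * K k)ᴴ)).re ≤
    (Matrix.trace (M * (∑ k, K k * B * (K k)ᴴ) * Mᴴ)).re := by
  set Y := ∑ k, (K k)ᴴ * M * K k with hY
  have h0 : 0 ≤ (∑ k, Matrix.trace ((M * K k - K k * Y) * B * (M * K k - K k * Y)ᴴ)).re := by
    rw [Complex.re_sum]
    exact Finset.sum_nonneg fun k _ => tr_nonneg hB _
  have e : ∀ k, Matrix.trace ((M * K k - K k * Y) * B * (M * K k - K k * Y)ᴴ) =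
     Matrix.trace (M * (K k * B * (K k)ᴴ) * Mᴴ) - Matrix.trace (((K k)ᴴ * M * K k) * (B * Yᴴ))
      - Matrix.trace (Y * B * ((K k)ᴴ * M * K k)ᴴ) + Matrix.trace (((K k)ᴴ * K k) * (Y * B * Yᴴ)) := by
    intro k
    have a1 : Matrix.trace (((K k)ᴴ * M * K k) * (B * Yᴴ)) = Matrix.trace (M * K k * B * (K k * Y)ᴴ) := by
      rw [Matrix.mul_assoc, Matrix.mul_assoc, Matrix.trace_mul_comm]
      simp only [Matrix.conjTranspose_mul, Matrix.mul_assoc]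
    have a2 : Matrix.trace (Y * B * ((K k)ᴴ * M * K k)ᴴ) = Matrix.trace (K k * Y * B * (M * K k)ᴴ) := by
      simp only [Matrix.conjTranspose_mul, Matrix.mul_assoc, Matrix.conjTranspose_conjTranspose]
      rw [Matrix.trace_mul_comm (K k)]
      simp only [Matrix.mul_assoc]
    have a3 : Matrix.trace (((K k)ᴴ * K k) * (Y * B * Yᴴ)) = Matrix.trace (K k * Y * B * (K k * Y)ᴴ) := by
      rw [Matrix.mul_assoc, Matrix.trace_mul_comm]
      simp only [Matrix.conjTranspose_mul, Matrix.mul_assoc]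
    rw [a1, a2, a3]
    simp only [Matrix.conjTranspose_sub, Matrix.sub_mul, Matrix.mul_sub, Matrix.trace_sub, Matrix.conjTranspose_mul, Matrix.mul_assoc]
    ring
  simp only [e] at h0
  rw [Finset.sum_add_distrib, Finset.sum_sub_distrib, Finset.sum_sub_distrib, ← Matrix.trace_sum, ← Matrix.trace_sum,
    ← Matrix.trace_sum, ← Matrix.trace_sum, ← Finset.sum_mul, ← Finset.sum_mul, ← Finset.sum_mul, ← Finset.mul_sum,
    ← Finset.mul_sum, ← Matrix.conjTranspose_sum, ← hY, hK, Matrix.one_mul, ← Matrix.mul_assoc] at h0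
  simp only [Complex.add_re, Complex.sub_re] at h0
  linarith

theorem kraus {d : ℕ} {κ : Type} [Fintype κ] (K : κ → Matrix (Fin d) (Fin d) ℂ)
    (hK : ∑ k, (K k)ᴴ * K k = 1) {A B : Matrix (Fin d) (Fin d) ℂ} (hA : A.PosDef) (hB : B.PosDef)
    (htr : A.trace = 1)
    (hA' : (∑ k, K k * A * (K k)ᴴ).PosDef) (hB' : (∑ k, K k * B * (K k)ᴴ).PosDef) :
    qRelEnt (∑ k, K k * A * (K k)ᴴ) (∑ k, K k * B * (K k)ᴴ) ≤ qRelEnt A B := by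
  have tr : ∀ M, Matrix.trace (M * ∑ k, K k * A * (K k)ᴴ) = Matrix.trace ((∑ k, (K k)ᴴ * M * K k) * A) := by
    intro M
    rw [Finset.mul_sum, Finset.sum_mul, Matrix.trace_sum, Matrix.trace_sum]
    refine Finset.sum_congr rfl fun k _ => ?_
    rw [← Matrix.mul_assoc, Matrix.trace_mul_comm]
    simp only [Matrix.mul_assoc]
  refine main hA hB hA' hB' htr ?_ ?_
  · have := tr 1
    simpa [hK, htr] using this
  · intro t ht M
    refine ⟨∑ k, (K k)ᴴ * M * K k, ?_⟩
    have h1 := KS K hK hB M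
    have h2 := KS K hK hA Mᴴ
    have e : (∑ k, (K k)ᴴ * Mᴴ * K k) = (∑ k, (K k)ᴴ * M * K k)ᴴ := by
      simp [Matrix.conjTranspose_sum, Matrix.conjTranspose_mul, Matrix.mul_assoc]
    rw [e, Matrix.conjTranspose_conjTranspose, Matrix.conjTranspose_conjTranspose] at h2
    have h3 := mul_le_mul_of_nonneg_left h2 ht
    rw [Q, Q, tr]
    linarith

open Kronecker in
theorem exK {dS dE : ℕ} (ω : Matrix (Fin dE) (Fin dE) ℂ) (hω : ω.PosDef) (hωtr : Matrix.trace ω = 1)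
    (U : Matrix (Fin dS × Fin dE) (Fin dS × Fin dE) ℂ)
    (hU : U ∈ Matrix.unitaryGroup (Fin dS × Fin dE) ℂ) :
    ∃ K : Fin dE × Fin dE → Matrix (Fin dS) (Fin dS) ℂ, ∑ k, (K k)ᴴ * K k = 1 ∧
      ∀ A, ptraceE (U * (A ⊗ₖ ω) * Uᴴ) = ∑ k, K k * A * (K k)ᴴ := by
  obtain ⟨C, hC⟩ : ∃ C : Matrix (Fin dE) (Fin dE) ℂ, ω = C * Cᴴ := by
    refine ⟨(hω.isHermitian.eigenvectorUnitary : Matrix (Fin dE) (Fin dE) ℂ) *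
      Matrix.diagonal (fun i => ((Real.sqrt (hω.isHermitian.eigenvalues i) : ℝ) : ℂ)), ?_⟩
    rw [Matrix.conjTranspose_mul, Matrix.diagonal_conjTranspose, Matrix.mul_assoc, ← Matrix.mul_assoc (Matrix.diagonal _),
      Matrix.diagonal_mul_diagonal, ← Matrix.mul_assoc]
    refine (spec hω.isHermitian).trans ?_
    congr 3
    funext i
    have hp := (hω.eigenvalues_pos i).le
    simp only [Pi.star_apply, Complex.star_def, Complex.conj_ofReal]
    rw [← Complex.ofReal_mul, Real.mul_self_sqrt hp]
  -- T = U (1 ⊗ C)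
  let T := U * ((1 : Matrix (Fin dS) (Fin dS) ℂ) ⊗ₖ C)
  have hU1 : Uᴴ * U = 1 := Matrix.mem_unitaryGroup_iff'.1 hU
  have hT : Tᴴ * T = (1 : Matrix (Fin dS) (Fin dS) ℂ) ⊗ₖ (Cᴴ * C) := by
    simp only [T, Matrix.conjTranspose_mul]
    rw [Matrix.mul_assoc, ← Matrix.mul_assoc Uᴴ, hU1, Matrix.one_mul, Matrix.conjTranspose_kronecker,
      ← Matrix.mul_kronecker_mul]
    simp
  have hA : ∀ A : Matrix (Fin dS) (Fin dS) ℂ, U * (A ⊗ₖ ω) * Uᴴ = T * (A ⊗ₖ (1 : Matrix (Fin dE) (Fin dE) ℂ)) * Tᴴ := by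
    intro A
    have : A ⊗ₖ ω = ((1 : Matrix (Fin dS) (Fin dS) ℂ) ⊗ₖ C) * (A ⊗ₖ (1 : Matrix (Fin dE) (Fin dE) ℂ)) *
      ((1 : Matrix (Fin dS) (Fin dS) ℂ) ⊗ₖ C)ᴴ := by
      rw [Matrix.conjTranspose_kronecker, ← Matrix.mul_kronecker_mul, ← Matrix.mul_kronecker_mul]
      simp [hC]
    rw [this]
    simp only [T, Matrix.conjTranspose_mul, Matrix.mul_assoc]
  have hCt : Matrix.trace (Cᴴ * C) = 1 := by rw [Matrix.trace_mul_comm, ← hC, hωtr]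
  refine ⟨fun k => Matrix.of fun i j => T (i, k.1) (j, k.2), ?_, ?_⟩
  · ext a b
    have h : ∀ f, (Tᴴ * T) (a, f) (b, f) = (1 : Matrix (Fin dS) (Fin dS) ℂ) a b * (Cᴴ * C) f f := by
      intro f; rw [hT]; rfl
    have h2 : ∑ f, (Tᴴ * T) (a, f) (b, f) = (1 : Matrix (Fin dS) (Fin dS) ℂ) a b := by
      simp only [h]
      rw [← Finset.mul_sum]
      change _ * Matrix.trace (Cᴴ * C) = _
      rw [hCt, mul_one]
    rw [← h2]
    simp only [Matrix.sum_apply, Matrix.mul_apply, Fintype.sum_prod_type, Matrix.conjTranspose_apply, Matrix.of_apply]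
    rw [Finset.sum_comm]
    refine Finset.sum_congr rfl fun f _ => ?_
    rw [Finset.sum_comm]
  · intro A
    rw [hA]
    ext a b
    simp only [ptraceE, Matrix.of_apply, Matrix.sum_apply, Fintype.sum_prod_type]
    refine Finset.sum_congr rfl fun e _ => ?_
    simp only [Matrix.mul_apply, Fintype.sum_prod_type, Matrix.conjTranspose_apply, Matrix.of_apply, Matrix.kroneckerMap_apply,
      Matrix.one_apply, mul_ite, mul_one, mul_zero, Finset.sum_ite_eq', Finset.sum_ite_eq, Finset.mem_univ, if_true]
    rw [Finset.sum_comm]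

end DPIaux

open Kronecker in
/-- Monotonicity of the quantum relative entropy under Stinespring-form
channels `Φ(ρ) = Tr_E[U (ρ ⊗ ω) U†]`. -/
theorem qRelEnt_contracts_under_stinespring {dS dE : ℕ}
    (ρ σ : Matrix (Fin dS) (Fin dS) ℂ) (ω : Matrix (Fin dE) (Fin dE) ℂ)
    (hρ : ρ.PosDef) (hσ : σ.PosDef) (hω : ω.PosDef)
    (hρtr : Matrix.trace ρ = 1) (hσtr : Matrix.trace σ = 1) (hωtr : Matrix.trace ω = 1)
    (U : Matrix (Fin dS × Fin dE) (Fin dS × Fin dE) ℂ)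
    (hU : U ∈ Matrix.unitaryGroup (Fin dS × Fin dE) ℂ)
    (hΦρ : (ptraceE (U * (ρ ⊗ₖ ω) * Uᴴ)).PosDef)
    (hΦσ : (ptraceE (U * (σ ⊗ₖ ω) * Uᴴ)).PosDef) :
    qRelEnt (ptraceE (U * (ρ ⊗ₖ ω) * Uᴴ)) (ptraceE (U * (σ ⊗ₖ ω) * Uᴴ))
      ≤ qRelEnt ρ σ := by
  obtain ⟨K, hK, hΦ⟩ := DPIaux.exK ω hω hωtr U hU
  rw [hΦ] at hΦρ hΦσ ⊢
  rw [hΦ]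
  exact DPIaux.kraus K hK hρ hσ hρtr hΦρ hΦσ
end

section
/- Main theorem (quantum, qubit or general d): let Φ : M_d(ℂ) → M_d(ℂ) be a Hermitian-preserving linear map such that (i) there exists a positive definite matrix π with Φ(π) positive definite, and (ii) for every positive definite ρ with Φ(ρ) positive definite and every Hermitian δρ, K_{f,Φ(ρ)}(Φ(δρ),Φ(δρ)) ≤ K_{f,ρ}(δρ,δρ). Then Φ is a positive map: Φ(σ) is positive semidefinite for every positive semidefinite σ. -/
open Matrix Finset
open scoped ComplexOrder

/-- Quantum Fisher quadratic form `K_{f,ρ}(A,A)` in the eigenbasis of `ρ`. -/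
noncomputable def Kf (f : ℝ → ℝ) {d : ℕ} (ρ A : Matrix (Fin d) (Fin d) ℂ) : ℝ :=
  if h : ρ.IsHermitian then
    ∑ i, ∑ j,
      ‖((h.eigenvectorUnitary : Matrix (Fin d) (Fin d) ℂ)ᴴ * A *
        (h.eigenvectorUnitary : Matrix (Fin d) (Fin d) ℂ)) i j‖ ^ 2 /
        (h.eigenvalues j * f (h.eigenvalues i / h.eigenvalues j))
  else 0

theorem aux_spec {d : ℕ} {ρ : Matrix (Fin d) (Fin d) ℂ} (h : ρ.IsHermitian) :
    ρ = (h.eigenvectorUnitary : Matrix (Fin d) (Fin d) ℂ) *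
      diagonal (fun i => (h.eigenvalues i : ℂ)) *
      (h.eigenvectorUnitary : Matrix (Fin d) (Fin d) ℂ)ᴴ := by
  have := h.spectral_theorem
  rw [Unitary.conjStarAlgAut_apply] at this
  exact this

theorem aux_UU {d : ℕ} (U : Matrix.unitaryGroup (Fin d) ℂ) :
    (U : Matrix (Fin d) (Fin d) ℂ) * (U : Matrix (Fin d) (Fin d) ℂ)ᴴ = 1 :=
  Unitary.coe_mul_star_self U

theorem aux_UU' {d : ℕ} (U : Matrix.unitaryGroup (Fin d) ℂ) :
    (U : Matrix (Fin d) (Fin d) ℂ)ᴴ * (U : Matrix (Fin d) (Fin d) ℂ) = 1 :=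
  Unitary.coe_star_mul_self U

theorem aux_psd_of_le {d : ℕ} {ρ : Matrix (Fin d) (Fin d) ℂ} (h : ρ.IsHermitian) (c : ℝ)
    (hc : ∀ i, c ≤ h.eigenvalues i) :
    (ρ - (c : ℂ) • (1 : Matrix (Fin d) (Fin d) ℂ)).PosSemidef := by
  have h1 : ρ - (c : ℂ) • (1 : Matrix (Fin d) (Fin d) ℂ) =
      (h.eigenvectorUnitary : Matrix (Fin d) (Fin d) ℂ) *
      diagonal (fun i => ((h.eigenvalues i - c : ℝ) : ℂ)) *
      (h.eigenvectorUnitary : Matrix (Fin d) (Fin d) ℂ)ᴴ := by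
    have h2 : diagonal (fun i => ((h.eigenvalues i - c : ℝ) : ℂ)) =
      diagonal (fun i => (h.eigenvalues i : ℂ)) - (c : ℂ) • (1 : Matrix (Fin d) (Fin d) ℂ) := by
      ext i j
      by_cases hij : i = j
      · subst hij; simp
      · simp [hij]
    rw [h2, mul_sub, sub_mul, ← aux_spec h]
    simp [aux_UU]
  rw [h1]
  apply PosSemidef.mul_mul_conjTranspose_same
  rw [posSemidef_diagonal_iff]
  intro i
  have := hc i
  rw [Complex.zero_le_real]
  linarith

theorem aux_diag_le {d : ℕ} {B U : Matrix (Fin d) (Fin d) ℂ} (c : ℝ)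
    (hB : (B - (c : ℂ) • (1 : Matrix (Fin d) (Fin d) ℂ)).PosSemidef) (hU : Uᴴ * U = 1) (i : Fin d) :
    c ≤ ((Uᴴ * B * U) i i).re := by
  have h := (hB.conjTranspose_mul_mul_same U).diag_nonneg (i := i)
  rw [mul_sub, sub_mul] at h
  rw [Matrix.mul_smul, Matrix.smul_mul, Matrix.mul_one, hU] at h
  have := (Complex.le_def.1 h).1
  simp at this
  linarith

theorem aux_Kf_eq (f : ℝ → ℝ) {d : ℕ} {ρ : Matrix (Fin d) (Fin d) ℂ} (h : ρ.IsHermitian)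
    (A : Matrix (Fin d) (Fin d) ℂ) : Kf f ρ A = ∑ i, ∑ j,
      ‖((h.eigenvectorUnitary : Matrix (Fin d) (Fin d) ℂ)ᴴ * A *
        (h.eigenvectorUnitary : Matrix (Fin d) (Fin d) ℂ)) i j‖ ^ 2 /
        (h.eigenvalues j * f (h.eigenvalues i / h.eigenvalues j)) := by
  unfold Kf
  rw [dif_pos h]

theorem aux_lower (f : ℝ → ℝ) (hfpos : ∀ x > (0 : ℝ), 0 < f x) (hf1 : f 1 = 1)
    {d : ℕ} {ρ B : Matrix (Fin d) (Fin d) ℂ} (hρ : ρ.PosDef) (c M : ℝ) (hc : 0 < c) (hM : 0 < M)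
    (hB : (B - (c : ℂ) • (1 : Matrix (Fin d) (Fin d) ℂ)).PosSemidef) (hK : Kf f ρ B ≤ M) :
    (ρ - ((c ^ 2 / M : ℝ) : ℂ) • (1 : Matrix (Fin d) (Fin d) ℂ)).PosSemidef := by
  apply aux_psd_of_le hρ.1
  intro i
  rw [aux_Kf_eq f hρ.1] at hK
  have hp := hρ.eigenvalues_pos
  have hnn : ∀ i j, 0 ≤ ‖((hρ.1.eigenvectorUnitary : Matrix (Fin d) (Fin d) ℂ)ᴴ * B *
        (hρ.1.eigenvectorUnitary : Matrix (Fin d) (Fin d) ℂ)) i j‖ ^ 2 /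
        (hρ.1.eigenvalues j * f (hρ.1.eigenvalues i / hρ.1.eigenvalues j)) := by
    intro i j
    have := hfpos _ (div_pos (hp i) (hp j))
    have := hp j
    positivity
  have h1 := Finset.single_le_sum (fun j _ => hnn i j) (Finset.mem_univ i)
  have h2 := Finset.single_le_sum (s := Finset.univ)
    (fun i _ => Finset.sum_nonneg (s := Finset.univ) (fun j _ => hnn i j)) (Finset.mem_univ i)
  have h3 := (h1.trans h2).trans hK
  rw [div_self (hp i).ne', hf1, mul_one, div_le_iff₀ (hp i)] at h3
  have h4 := aux_diag_le c hB (aux_UU' hρ.1.eigenvectorUnitary) i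
  have h5 := h4.trans ((le_abs_self _).trans (Complex.abs_re_le_norm _))
  rw [div_le_iff₀ hM]
  nlinarith

theorem aux_pd_lower {d : ℕ} [NeZero d] {B : Matrix (Fin d) (Fin d) ℂ} (hB : B.PosDef) :
    ∃ c : ℝ, 0 < c ∧ (B - (c : ℂ) • (1 : Matrix (Fin d) (Fin d) ℂ)).PosSemidef := by
  obtain ⟨i, hi⟩ := Finite.exists_min hB.1.eigenvalues
  exact ⟨_, hB.eigenvalues_pos i, aux_psd_of_le hB.1 _ hi⟩

theorem aux_pd_of_lower {d : ℕ} {B : Matrix (Fin d) (Fin d) ℂ} (c : ℝ) (hc : 0 < c)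
    (h : (B - (c : ℂ) • (1 : Matrix (Fin d) (Fin d) ℂ)).PosSemidef) : B.PosDef := by
  have : ((c : ℂ) • (1 : Matrix (Fin d) (Fin d) ℂ)).PosDef :=
    PosDef.one.smul (by exact_mod_cast hc)
  simpa using PosDef.posSemidef_add h this

theorem aux_closed {d : ℕ} {X : Type*} [TopologicalSpace X] (g : X → Matrix (Fin d) (Fin d) ℂ)
    (hg : Continuous g) (hh : ∀ x, (g x).IsHermitian) : IsClosed {x | (g x).PosSemidef} := by
  have : {x | (g x).PosSemidef} = ⋂ v : Fin d → ℂ, {x | 0 ≤ (star v ⬝ᵥ (g x *ᵥ v))} := by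
    ext x
    simp [posSemidef_iff_dotProduct_mulVec, hh x]
  rw [this]
  refine isClosed_iInter fun v => isClosed_le continuous_const ?_
  fun_prop

theorem aux_open {d : ℕ} {X : Type*} [TopologicalSpace X] (g : X → Matrix (Fin d) (Fin d) ℂ)
    (hg : Continuous g) (hh : ∀ x, (g x).IsHermitian) : IsOpen {x | (g x).PosDef} := by
  rw [isOpen_iff_eventually]
  intro x₀ hx₀
  have hx₀ : (g x₀).PosDef := hx₀
  have key : ∀ᶠ x in nhds x₀, ∀ v ∈ Metric.sphere (0 : Fin d → ℂ) 1,
      0 < (star v ⬝ᵥ (g x *ᵥ v)).re := by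
    apply IsCompact.eventually_forall_of_forall_eventually (isCompact_sphere _ _)
    intro v hv
    have hv0 : v ≠ 0 := by
      rintro rfl
      simp at hv
    have hcont : Continuous fun z : X × (Fin d → ℂ) => (star z.2 ⬝ᵥ (g z.1 *ᵥ z.2)).re := by
      fun_prop
    exact hcont.continuousAt.eventually (lt_mem_nhds (hx₀.re_dotProduct_pos hv0))
  filter_upwards [key] with x hx
  show (g x).PosDef
  apply PosDef.of_dotProduct_mulVec_pos (hh x)
  intro v hv
  have hn : 0 < ‖v‖ := norm_pos_iff.2 hv
  have h1 := hx (((‖v‖⁻¹ : ℝ) : ℂ) • v) (by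
    simp [norm_smul, hn.ne'])
  have him : (star v ⬝ᵥ (g x *ᵥ v)).im = 0 := (hh x).im_star_dotProduct_mulVec_self v
  rw [Complex.pos_iff]
  refine ⟨?_, him.symm⟩
  simp only [mulVec_smul, star_smul, smul_dotProduct, dotProduct_smul, smul_eq_mul,
    RCLike.star_def, Complex.conj_ofReal, Complex.re_ofReal_mul] at h1
  have := inv_pos.2 hn
  exact pos_of_mul_pos_right (pos_of_mul_pos_right h1 this.le) this.le

theorem aux_key (f : ℝ → ℝ) (hfpos : ∀ x > (0 : ℝ), 0 < f x) (hf1 : f 1 = 1) {d : ℕ} [NeZero d]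
    (Φ : Matrix (Fin d) (Fin d) ℂ →ₗ[ℂ] Matrix (Fin d) (Fin d) ℂ)
    (hherm : ∀ A : Matrix (Fin d) (Fin d) ℂ, Φ Aᴴ = (Φ A)ᴴ)
    (hcontr : ∀ (ρ A : Matrix (Fin d) (Fin d) ℂ), ρ.PosDef → (Φ ρ).PosDef →
      A.IsHermitian → Kf f (Φ ρ) (Φ A) ≤ Kf f ρ A)
    {X : Type*} [TopologicalSpace X] [PreconnectedSpace X] (γ : X → Matrix (Fin d) (Fin d) ℂ)
    (hγ : Continuous γ) (hpd : ∀ x, (γ x).PosDef) (x₀ x₁ : X) (h0 : (Φ (γ x₀)).PosDef)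
    (A : Matrix (Fin d) (Fin d) ℂ) (hA : A.IsHermitian) (hΦA : (Φ A).PosDef) (M : ℝ)
    (hM : ∀ x, Kf f (γ x) A ≤ M) : (Φ (γ x₁)).PosDef := by
  obtain ⟨c, hc, hcA⟩ := aux_pd_lower hΦA
  have hM' : 0 < max M 1 := lt_max_of_lt_right one_pos
  have hH : ∀ x, (Φ (γ x)).IsHermitian := by
    intro x
    unfold IsHermitian
    rw [← hherm, (hpd x).1.eq]
  have hcont : Continuous fun x => Φ (γ x) :=
    (LinearMap.continuous_of_finiteDimensional Φ).comp hγ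
  have hopen := aux_open _ hcont hH
  have hcl : IsClosed {x | (Φ (γ x)).PosDef} := by
    have : {x | (Φ (γ x)).PosDef} = {x | (Φ (γ x) -
        ((c ^ 2 / max M 1 : ℝ) : ℂ) • (1 : Matrix (Fin d) (Fin d) ℂ)).PosSemidef} := by
      ext x
      constructor
      · intro h
        exact aux_lower f hfpos hf1 h c _ hc hM' hcA
          ((hcontr _ _ (hpd x) h hA).trans ((hM x).trans (le_max_left _ _)))
      · intro h
        exact aux_pd_of_lower _ (by positivity) h
    rw [this]
    apply aux_closed _ (hcont.sub continuous_const)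
    intro x
    refine (hH x).sub ?_
    simp [IsHermitian]
  have huniv := IsClopen.eq_univ (s := {x | (Φ (γ x)).PosDef}) ⟨hcl, hopen⟩ ⟨x₀, h0⟩
  have : x₁ ∈ {x | (Φ (γ x)).PosDef} := huniv ▸ Set.mem_univ x₁
  exact this

theorem aux_frob {d : ℕ} (A U : Matrix (Fin d) (Fin d) ℂ) (hU : U * Uᴴ = 1) (i j : Fin d) :
    ‖(Uᴴ * A * U) i j‖ ^ 2 ≤ (Aᴴ * A).trace.re := by
  have htr : ∀ B : Matrix (Fin d) (Fin d) ℂ, (Bᴴ * B).trace.re = ∑ j, ∑ i, ‖B i j‖ ^ 2 := by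
    intro B
    simp [Matrix.trace, Matrix.mul_apply, Complex.sq_norm, Complex.normSq_apply]
  have h1 : (Aᴴ * A).trace = ((Uᴴ * A * U)ᴴ * (Uᴴ * A * U)).trace := by
    have : (Uᴴ * A * U)ᴴ * (Uᴴ * A * U) = Uᴴ * (Aᴴ * (U * Uᴴ) * A * U) := by
      simp [Matrix.mul_assoc]
    rw [this, Matrix.trace_mul_comm Uᴴ, hU, Matrix.mul_assoc _ U, hU]
    simp
  rw [h1, htr]
  exact (Finset.single_le_sum (f := fun i => ‖(Uᴴ * A * U) i j‖ ^ 2) (fun _ _ => by positivity)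
    (Finset.mem_univ i)).trans
    (Finset.single_le_sum (f := fun j => ∑ i, ‖(Uᴴ * A * U) i j‖ ^ 2)
      (fun _ _ => by positivity) (Finset.mem_univ j))

/-- conjugation by a Hermitian involution preserves the good cone -/
theorem aux_invol (f : ℝ → ℝ) (hfpos : ∀ x > (0 : ℝ), 0 < f x) (hf1 : f 1 = 1) {d : ℕ} [NeZero d]
    (Φ : Matrix (Fin d) (Fin d) ℂ →ₗ[ℂ] Matrix (Fin d) (Fin d) ℂ)
    (hherm : ∀ A : Matrix (Fin d) (Fin d) ℂ, Φ Aᴴ = (Φ A)ᴴ)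
    (hcontr : ∀ (ρ A : Matrix (Fin d) (Fin d) ℂ), ρ.PosDef → (Φ ρ).PosDef →
      A.IsHermitian → Kf f (Φ ρ) (Φ A) ≤ Kf f ρ A)
    (ρ S : Matrix (Fin d) (Fin d) ℂ) (hρ : ρ.PosDef) (hΦ : (Φ ρ).PosDef)
    (hS : S.IsHermitian) (hSS : S * S = 1) : (Φ (S * ρ * S)).PosDef := by
  set U : ℝ → Matrix (Fin d) (Fin d) ℂ := fun t =>
    (Real.cos t : ℂ) • (1 : Matrix (Fin d) (Fin d) ℂ) + (Complex.I * Real.sin t : ℂ) • S with hUdef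
  have hUH : ∀ t, (U t)ᴴ = (Real.cos t : ℂ) • (1 : Matrix (Fin d) (Fin d) ℂ)
      - (Complex.I * Real.sin t : ℂ) • S := by
    intro t
    simp only [hUdef, conjTranspose_add, conjTranspose_smul, hS.eq, conjTranspose_one, star_mul',
      RCLike.star_def, Complex.conj_ofReal, Complex.conj_I, neg_mul, neg_smul, sub_eq_add_neg]
  have hcs : ∀ t : ℝ, (Real.cos t : ℂ) * Real.cos t + Real.sin t * Real.sin t = 1 := by
    intro t
    have := Real.cos_sq_add_sin_sq t
    have h2 : Real.cos t * Real.cos t + Real.sin t * Real.sin t = 1 := by nlinarith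
    exact_mod_cast h2
  have hI := Complex.I_mul_I
  have hUU : ∀ t, U t * (U t)ᴴ = 1 := by
    intro t
    have h3 : U t * (U t)ᴴ = ((Real.cos t : ℂ) * Real.cos t + Real.sin t * Real.sin t) •
        (1 : Matrix (Fin d) (Fin d) ℂ) := by
      rw [hUH]
      simp only [hUdef, add_mul, mul_sub, smul_mul_smul_comm, hSS, one_mul, mul_one]
      have : (Complex.I * (Real.sin t : ℂ)) * (Complex.I * (Real.sin t : ℂ)) =
        - (Real.sin t * Real.sin t) := by linear_combination ((Real.sin t : ℂ) * Real.sin t) * hI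
      rw [this, mul_comm (Real.cos t : ℂ) (Complex.I * (Real.sin t : ℂ))]
      module
    rw [h3, hcs, one_smul]
  have hUU' : ∀ t, (U t)ᴴ * U t = 1 := fun t => mul_eq_one_comm.1 (hUU t)
  have hcont : Continuous U := by
    simp only [hUdef]
    fun_prop
  have hpd : ∀ t, (U t * ρ * (U t)ᴴ).PosDef := by
    intro t
    apply hρ.mul_mul_conjTranspose_same
    intro v w hvw
    have := congrArg (fun z => z ᵥ* (U t)ᴴ) hvw
    simpa [hUU t] using this
  have hev : ∀ t, (hpd t).1.eigenvalues = hρ.1.eigenvalues := by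
    intro t
    rw [IsHermitian.eigenvalues_eq_eigenvalues_iff, Matrix.charpoly_mul_comm, ← mul_assoc, hUU',
      one_mul]
  have hfin := aux_key f hfpos hf1 Φ hherm hcontr (fun t : ℝ => U t * ρ * (U t)ᴴ)
    (by fun_prop) hpd 0 (Real.pi / 2) (by simpa [hUdef] using hΦ) ρ hρ.1 hΦ
    (∑ i, ∑ j, (ρᴴ * ρ).trace.re /
      (hρ.1.eigenvalues j * f (hρ.1.eigenvalues i / hρ.1.eigenvalues j))) (by
      intro t
      rw [aux_Kf_eq f (hpd t).1, hev t]
      refine Finset.sum_le_sum fun i _ => Finset.sum_le_sum fun j _ => ?_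
      have hi := hρ.eigenvalues_pos i
      have hj := hρ.eigenvalues_pos j
      have := hfpos _ (div_pos hi hj)
      exact div_le_div_of_nonneg_right (aux_frob _ _ (aux_UU _) i j) (by positivity))
  have h4 : U (Real.pi / 2) * ρ * (U (Real.pi / 2))ᴴ = S * ρ * S := by
    rw [hUH]
    simp [hUdef, smul_smul, hI]
  rw [← h4]
  exact hfin

theorem aux_one (f : ℝ → ℝ) (hfpos : ∀ x > (0 : ℝ), 0 < f x) (hf1 : f 1 = 1) {d : ℕ} [NeZero d]
    (Φ : Matrix (Fin d) (Fin d) ℂ →ₗ[ℂ] Matrix (Fin d) (Fin d) ℂ)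
    (hherm : ∀ A : Matrix (Fin d) (Fin d) ℂ, Φ Aᴴ = (Φ A)ᴴ)
    (hcontr : ∀ (ρ A : Matrix (Fin d) (Fin d) ℂ), ρ.PosDef → (Φ ρ).PosDef →
      A.IsHermitian → Kf f (Φ ρ) (Φ A) ≤ Kf f ρ A)
    (ρ : Matrix (Fin d) (Fin d) ℂ) (hρ : ρ.PosDef) (hΦ : (Φ ρ).PosDef) :
    (Φ 1).PosDef := by
  set V : Matrix (Fin d) (Fin d) ℂ := (hρ.1.eigenvectorUnitary : Matrix (Fin d) (Fin d) ℂ)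
  have hV1 : V * Vᴴ = 1 := aux_UU _
  have hV2 : Vᴴ * V = 1 := aux_UU' _
  set D : Fin d → ℂ := fun i => (hρ.1.eigenvalues i : ℂ) with hD
  have hsp : ρ = V * diagonal D * Vᴴ := aux_spec hρ.1
  let P : Fin d → Matrix (Fin d) (Fin d) ℂ := fun k => Matrix.of fun i j => if j = k - i then 1 else 0
  have hPH : ∀ k, (P k)ᴴ = P k := by
    intro k
    ext i j
    have : (i = k - j) ↔ (j = k - i) := by
      constructor <;> (rintro rfl; simp)
    simp [P, this]
  have hPDP : ∀ k (D : Fin d → ℂ), P k * diagonal D * P k = diagonal fun i => D (k - i) := by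
    intro k D
    ext i j
    rw [Matrix.mul_apply, Finset.sum_eq_single (k - i)]
    · simp [P, Matrix.mul_diagonal, Matrix.diagonal_apply, eq_comm]
    · intro l _ hl
      simp [P, Matrix.mul_diagonal, hl]
    · simp
  have hPP : ∀ k, P k * P k = 1 := by
    intro k
    have := hPDP k (fun _ => 1)
    simpa using this
  have hgood : ∀ k, (Φ (V * (diagonal fun i => D (k - i)) * Vᴴ)).PosDef := by
    intro k
    have h := aux_invol f hfpos hf1 Φ hherm hcontr ρ (V * P k * Vᴴ) hρ hΦ
      (by simp [IsHermitian, hPH, Matrix.mul_assoc]) (by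
        calc V * P k * Vᴴ * (V * P k * Vᴴ) = V * (P k * (Vᴴ * V) * P k) * Vᴴ := by
              simp only [Matrix.mul_assoc]
          _ = 1 := by rw [hV2, mul_one, hPP, mul_one, hV1])
    have h2 : V * P k * Vᴴ * ρ * (V * P k * Vᴴ) = V * (diagonal fun i => D (k - i)) * Vᴴ := by
      rw [← hPDP, hsp]
      calc _ = V * (P k * (Vᴴ * V) * diagonal D * (Vᴴ * V) * P k) * Vᴴ := by
              simp only [Matrix.mul_assoc]
        _ = _ := by rw [hV2, mul_one, mul_one]
    rwa [h2] at h
  have hsum : ∑ k, V * (diagonal fun i => D (k - i)) * Vᴴ = (∑ i, D i) • 1 := by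
    rw [← Finset.sum_mul, ← Finset.mul_sum]
    have : ∑ k, (diagonal fun i => D (k - i)) = (∑ i, D i) • (1 : Matrix (Fin d) (Fin d) ℂ) := by
      ext i j
      rw [Matrix.sum_apply]
      by_cases hij : i = j
      · subst hij
        simp only [diagonal_apply_eq, Matrix.smul_apply, one_apply_eq, smul_eq_mul, mul_one]
        exact (Equiv.subRight i).sum_comp D
      · simp [hij]
    rw [this]
    simp [hV1]
  have h5 : (∑ k, Φ (V * (diagonal fun i => D (k - i)) * Vᴴ)).PosDef :=
    posDef_sum Finset.univ_nonempty (fun k _ => hgood k)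
  rw [← map_sum, hsum, map_smul] at h5
  have hT : (0 : ℝ) < ∑ i, hρ.1.eigenvalues i :=
    Finset.sum_pos (fun i _ => hρ.eigenvalues_pos i) Finset.univ_nonempty
  have hTD : (∑ i, D i) = ((∑ i, hρ.1.eigenvalues i : ℝ) : ℂ) := by simp [hD]
  rw [hTD] at h5
  have h6 := h5.smul (α := ℂ) (a := (((∑ i, hρ.1.eigenvalues i)⁻¹ : ℝ) : ℂ))
    (by rw [Complex.zero_lt_real]; positivity)
  rw [smul_smul, ← Complex.ofReal_mul, inv_mul_cancel₀ hT.ne', Complex.ofReal_one, one_smul] at h6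
  exact h6

theorem aux_eps (f : ℝ → ℝ) (hfpos : ∀ x > (0 : ℝ), 0 < f x) (hf1 : f 1 = 1) {d : ℕ} [NeZero d]
    (Φ : Matrix (Fin d) (Fin d) ℂ →ₗ[ℂ] Matrix (Fin d) (Fin d) ℂ)
    (hherm : ∀ A : Matrix (Fin d) (Fin d) ℂ, Φ Aᴴ = (Φ A)ᴴ)
    (hcontr : ∀ (ρ A : Matrix (Fin d) (Fin d) ℂ), ρ.PosDef → (Φ ρ).PosDef →
      A.IsHermitian → Kf f (Φ ρ) (Φ A) ≤ Kf f ρ A) (h1 : (Φ 1).PosDef)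
    (σ : Matrix (Fin d) (Fin d) ℂ) (hσ : σ.PosSemidef) (ε : ℝ) (hε : 0 < ε) :
    (Φ (σ + (ε : ℂ) • 1)).PosDef := by
  have hε' : (0 : ℂ) < ε := by exact_mod_cast hε
  have hsub : ∀ t : unitInterval, ((((t : ℝ) : ℂ) • σ + (ε : ℂ) • 1)
      - (ε : ℂ) • (1 : Matrix (Fin d) (Fin d) ℂ)).PosSemidef := by
    intro t
    rw [add_sub_cancel_right]
    exact hσ.smul (by exact_mod_cast t.2.1)
  have hpd : ∀ t : unitInterval, (((t : ℝ) : ℂ) • σ + (ε : ℂ) • 1).PosDef :=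
    fun t => aux_pd_of_lower ε hε (hsub t)
  have := aux_key f hfpos hf1 Φ hherm hcontr
    (fun t : unitInterval => ((t : ℝ) : ℂ) • σ + (ε : ℂ) • 1)
    (by fun_prop) hpd 0 1 (by simpa using h1.smul hε') 1 isHermitian_one h1
    (∑ _i : Fin d, 1 / ε) (by
      intro t
      rw [aux_Kf_eq f (hpd t).1, mul_one, aux_UU']
      refine Finset.sum_le_sum fun i _ => ?_
      have hi := (hpd t).eigenvalues_pos i
      rw [Finset.sum_eq_single i]
      · rw [div_self hi.ne', hf1, mul_one, one_apply_eq]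
        simp only [norm_one, one_pow]
        have h4 := aux_diag_le ε (hsub t) (aux_UU' (hpd t).1.eigenvectorUnitary) i
        have h5 : (((hpd t).1.eigenvectorUnitary : Matrix (Fin d) (Fin d) ℂ)ᴴ *
            (((t : ℝ) : ℂ) • σ + (ε : ℂ) • 1) *
            ((hpd t).1.eigenvectorUnitary : Matrix (Fin d) (Fin d) ℂ)) =
            diagonal (fun i => ((hpd t).1.eigenvalues i : ℂ)) := by
          have h6 := congrArg (fun Z => ((hpd t).1.eigenvectorUnitary : Matrix (Fin d) (Fin d) ℂ)ᴴ *
            Z * ((hpd t).1.eigenvectorUnitary : Matrix (Fin d) (Fin d) ℂ)) (aux_spec (hpd t).1)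
          refine h6.trans ?_
          simp only [Matrix.mul_assoc, aux_UU', mul_one]
          rw [← Matrix.mul_assoc, aux_UU', one_mul]
        rw [h5] at h4
        simp only [diagonal_apply_eq, Complex.ofReal_re] at h4
        exact one_div_le_one_div_of_le hε h4
      · intro j _ hj
        simp [one_apply_ne hj.symm]
      · simp)
  simpa using this

theorem fisher_contraction_implies_positive_map {d : ℕ} (f : ℝ → ℝ)
    (hfpos : ∀ x > (0 : ℝ), 0 < f x) (hf1 : f 1 = 1)
    (hfsymm : ∀ x > (0 : ℝ), x * f (1 / x) = f x)
    (Φ : Matrix (Fin d) (Fin d) ℂ →ₗ[ℂ] Matrix (Fin d) (Fin d) ℂ)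
    (hherm : ∀ A : Matrix (Fin d) (Fin d) ℂ, Φ Aᴴ = (Φ A)ᴴ)
    (hexists : ∃ π : Matrix (Fin d) (Fin d) ℂ, π.PosDef ∧ (Φ π).PosDef)
    (hcontr : ∀ (ρ A : Matrix (Fin d) (Fin d) ℂ), ρ.PosDef → (Φ ρ).PosDef →
      A.IsHermitian → Kf f (Φ ρ) (Φ A) ≤ Kf f ρ A) :
    ∀ σ : Matrix (Fin d) (Fin d) ℂ, σ.PosSemidef → (Φ σ).PosSemidef := by
  intro σ hσ
  rcases Nat.eq_zero_or_pos d with hd | hd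
  · subst hd
    rw [Subsingleton.elim (Φ σ) 0]
    exact PosSemidef.zero
  haveI : NeZero d := ⟨hd.ne'⟩
  obtain ⟨π, hπ, hΦπ⟩ := hexists
  have h1 := aux_one f hfpos hf1 Φ hherm hcontr π hπ hΦπ
  have hcont : Continuous fun t : ℝ => Φ (σ + (t : ℂ) • 1) :=
    (LinearMap.continuous_of_finiteDimensional Φ).comp (by fun_prop)
  have hcl := aux_closed (fun t : ℝ => Φ (σ + (t : ℂ) • 1)) hcont (by
    intro t
    unfold IsHermitian
    rw [← hherm]
    simp [hσ.1.eq])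
  have hmem : (0 : ℝ) ∈ closure (Set.Ioi (0 : ℝ)) := by simp
  have hsub : Set.Ioi (0 : ℝ) ⊆ {t : ℝ | (Φ (σ + (t : ℂ) • 1)).PosSemidef} := fun t ht =>
    (aux_eps f hfpos hf1 Φ hherm hcontr h1 σ hσ t ht).posSemidef
  have h0 : (0 : ℝ) ∈ {t : ℝ | (Φ (σ + (t : ℂ) • 1)).PosSemidef} :=
    closure_minimal hsub hcl hmem
  simpa using h0
end
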